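/- Let k be a field of characteristic not 2, K a field extension of k, and n ≥ 1. Suppose A ∈ Sp(2n,K) is such that for every X ∈ Sp(2n,k) (viewed as a matrix over K), every entry of A⁻¹XA lies in the image of k in K. Then for all row indices r, s and column indices i, j, the product A_{r,i}·A_{s,j} of entries of A lies in the image of k in K. -/

import Mathlib

open Matrix

/-- The standard symplectic form matrix `J = [[0, Iₙ], [-Iₙ, 0]]`. -/
def SpJ (n : ℕ) (R : Type*) [CommRing R] : Matrix (Fin n ⊕ Fin n) (Fin n ⊕ Fin n) R :=
  Matrix.fromBlocks 0 1 (-1) 0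

/-- `M` belongs to the symplectic group `Sp(2n,R)`, i.e. `Mᵀ J M = J`. -/
def IsSymp {n : ℕ} {R : Type*} [CommRing R]
    (M : Matrix (Fin n ⊕ Fin n) (Fin n ⊕ Fin n) R) : Prop :=
  Mᵀ * SpJ n R * M = SpJ n R

theorem SpJ_mul_self (n : ℕ) (R : Type*) [CommRing R] : SpJ n R * SpJ n R = -1 := by
  rw [SpJ, fromBlocks_multiply, ← fromBlocks_one, fromBlocks_neg]
  simp

theorem SpJ_transpose (n : ℕ) (R : Type*) [CommRing R] : (SpJ n R)ᵀ = -SpJ n R := by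
  simp [SpJ, fromBlocks_transpose, fromBlocks_neg]

theorem SpJ_map (n : ℕ) {R S : Type*} [CommRing R] [CommRing S] (f : R →+* S) :
    (SpJ n R).map f = SpJ n S := by
  simp [SpJ, fromBlocks_map, Matrix.map_neg]

theorem dotProduct_SpJ_mulVec_self {n : ℕ} {R : Type*} [CommRing R] (w : Fin n ⊕ Fin n → R) :
    w ⬝ᵥ (SpJ n R *ᵥ w) = 0 := by
  simp [SpJ, fromBlocks_mulVec, dotProduct, neg_mulVec, mul_comm]

/-- The symplectic transvection `1 + J w wᵀ`. -/
theorem isSymp_one_add_SpJ_mul_vecMulVec {n : ℕ} {R : Type*} [CommRing R]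
    (w : Fin n ⊕ Fin n → R) : IsSymp (1 + SpJ n R * vecMulVec w w) := by
  have hS : vecMulVec w w * SpJ n R * vecMulVec w w = 0 := by
    rw [Matrix.mul_assoc, mul_vecMulVec, vecMulVec_mul_vecMulVec, dotProduct_SpJ_mulVec_self]
    simp
  have hT : (vecMulVec w w)ᵀ = vecMulVec w w := by
    rw [transpose_vecMulVec]
  rw [IsSymp, transpose_add, transpose_one, transpose_mul, hT, SpJ_transpose]
  calc (1 + vecMulVec w w * -SpJ n R) * SpJ n R * (1 + SpJ n R * vecMulVec w w)
      = SpJ n R - vecMulVec w w * (SpJ n R * SpJ n R) + SpJ n R * SpJ n R * vecMulVec w w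
        - vecMulVec w w * (SpJ n R * SpJ n R) * SpJ n R * vecMulVec w w := by noncomm_ring
    _ = SpJ n R + vecMulVec w w * SpJ n R * vecMulVec w w := by
      rw [SpJ_mul_self]; noncomm_ring
    _ = SpJ n R := by rw [hS, add_zero]

theorem IsSymp.inv_eq {n : ℕ} {R : Type*} [CommRing R]
    {A : Matrix (Fin n ⊕ Fin n) (Fin n ⊕ Fin n) R} (hA : IsSymp A) :
    A⁻¹ = -(SpJ n R * Aᵀ * SpJ n R) := by
  apply inv_eq_left_inv
  have h : Aᵀ * SpJ n R * A = SpJ n R := hA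
  rw [Matrix.neg_mul, Matrix.mul_assoc, Matrix.mul_assoc, ← Matrix.mul_assoc Aᵀ, h, SpJ_mul_self,
    neg_neg]

/-- Conjugating the transvection `1 + J w wᵀ` by a symplectic matrix `A` gives
`1 + J u uᵀ` with `u = wᵀ A`. -/
theorem IsSymp.inv_mul_transvection_mul {n : ℕ} {R : Type*} [CommRing R]
    {A : Matrix (Fin n ⊕ Fin n) (Fin n ⊕ Fin n) R} (hA : IsSymp A) (w : Fin n ⊕ Fin n → R) :
    A⁻¹ * (1 + SpJ n R * vecMulVec w w) * A = 1 + SpJ n R * vecMulVec (w ᵥ* A) (w ᵥ* A) := by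
  have hu : vecMulVec (w ᵥ* A) (w ᵥ* A) = Aᵀ * vecMulVec w w * A := by
    rw [mul_vecMulVec, vecMulVec_mul, mulVec_transpose]
  have hone : A⁻¹ * A = 1 := by
    rw [hA.inv_eq, Matrix.neg_mul, Matrix.mul_assoc, Matrix.mul_assoc, ← Matrix.mul_assoc Aᵀ,
      show Aᵀ * SpJ n R * A = SpJ n R from hA, SpJ_mul_self, neg_neg]
  have hJ : A⁻¹ * SpJ n R = SpJ n R * Aᵀ := by
    rw [hA.inv_eq, Matrix.neg_mul, Matrix.mul_assoc, SpJ_mul_self]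
    simp
  rw [hu, Matrix.mul_add, Matrix.mul_one, Matrix.add_mul, hone, ← Matrix.mul_assoc, hJ]
  simp only [Matrix.mul_assoc]

/-- If all products within a row, and all symmetrized products of two rows, lie in a subfield in
which `2` is invertible, then so do all products of entries. -/
theorem mul_mem_of_symmetrized_mul_mem {m o K : Type*} [Field K] (F : Subfield K)
    (h2 : (2 : K) ≠ 0) (A : Matrix m o K) (hrow : ∀ r i j, A r i * A r j ∈ F)
    (hsymm : ∀ r s i j, A r i * A s j + A s i * A r j ∈ F) (r s : m) (i j : o) :
    A r i * A s j ∈ F := by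
  have hcol : ∀ r s i, A r i * A s i ∈ F := fun r s i => by
    have h := F.div_mem (hsymm r s i i) (ofNat_mem F 2)
    convert h using 1
    field_simp
    ring
  by_cases h0 : A r j = 0
  · simpa [h0] using hsymm r s i j
  · have h := F.div_mem (F.mul_mem (hrow r i j) (hcol r s j)) (hrow r j j)
    convert h using 1
    field_simp

/-- If `A ∈ Sp(2n,K)` is such that `Inn_A` maps every symplectic matrix over `k` to a matrix
with entries in (the image of) `k`, then every product `A_{r,i}·A_{s,j}` of entries of `A`
lies in the image of `k`. -/
theorem stmt2 {k K : Type*} [Field k] [Field K] [Algebra k K]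
    (hchar : (2 : k) ≠ 0) {n : ℕ} (hn : 1 ≤ n)
    (A : Matrix (Fin n ⊕ Fin n) (Fin n ⊕ Fin n) K) (hA : IsSymp A)
    (h : ∀ X : Matrix (Fin n ⊕ Fin n) (Fin n ⊕ Fin n) k, IsSymp X →
      ∀ i j, (A⁻¹ * X.map (algebraMap k K) * A) i j ∈ Set.range (algebraMap k K)) :
    ∀ r s i j, A r i * A s j ∈ Set.range (algebraMap k K) := by
  set f := algebraMap k K
  have hF : ∀ x, x ∈ Set.range f ↔ x ∈ f.fieldRange := fun x => by simp
  have key : ∀ (w : Fin n ⊕ Fin n → k) (i j),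
      ((f ∘ w) ᵥ* A) i * ((f ∘ w) ᵥ* A) j ∈ f.fieldRange := by
    intro w i j
    set u := (f ∘ w) ᵥ* A
    have hmap : (1 + SpJ n k * vecMulVec w w).map f
        = 1 + SpJ n K * vecMulVec (f ∘ w) (f ∘ w) := by
      rw [Matrix.map_add f (map_add f), Matrix.map_mul, SpJ_map, Matrix.map_one f (map_zero f)
        (map_one f)]
      congr 2
      ext a b
      simp [vecMulVec_apply]
    choose Y hY using h _ (isSymp_one_add_SpJ_mul_vecMulVec w)
    have hY' : Matrix.map (of Y) f = 1 + SpJ n K * vecMulVec u u := by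
      rw [← hA.inv_mul_transvection_mul, ← hmap]
      ext a b
      exact hY a b
    have hu : (SpJ n k * (1 - of Y)).map f = vecMulVec u u := by
      rw [Matrix.map_mul, SpJ_map, Matrix.map_sub f (map_sub f), hY', Matrix.map_one f (map_zero f)
        (map_one f), sub_add_cancel_left, Matrix.mul_neg, ← Matrix.mul_assoc, SpJ_mul_self]
      simp
    exact ⟨_, congrFun (congrFun hu i) j⟩
  have hsingle : ∀ r : Fin n ⊕ Fin n, (f ∘ Pi.single r 1) ᵥ* A = A r := fun r => by
    rw [show f ∘ Pi.single r 1 = Pi.single r (1 : K) by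
      ext a; simp [Pi.single_apply, apply_ite f], single_one_vecMul]
    rfl
  have hrow : ∀ r i j, A r i * A r j ∈ f.fieldRange := fun r i j => by
    simpa only [hsingle] using key (Pi.single r 1) i j
  intro r s i j
  rw [hF]
  refine mul_mem_of_symmetrized_mul_mem f.fieldRange ?_ A hrow (fun r s i j => ?_) r s i j
  · rw [← map_ofNat f 2]
    exact (map_ne_zero f).2 hchar
  · have h1 := key (Pi.single r 1 + Pi.single s 1) i j
    rw [show f ∘ (Pi.single r 1 + Pi.single s 1 : Fin n ⊕ Fin n → k)
      = f ∘ Pi.single r 1 + f ∘ Pi.single s 1 by ext; simp, add_vecMul, hsingle, hsingle] at h1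
    convert sub_mem (sub_mem h1 (hrow r i j)) (hrow s i j) using 1
    simp only [Pi.add_apply]
    ring
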